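/- Let C be the extended ternary quadratic residue code of length 14. The shell C_10 is not a combinatorial 4-design with repeated blocks: there is no natural number λ such that for every 4-element subset T of {1,…,14} the number of codewords c ∈ C with wt(c) = 10 and T ⊆ supp(c) equals λ. -/

import Mathlib

open scoped Classical

noncomputable section

/-- Membership in the ternary quadratic residue code of length 13: the codeword, viewed
as the polynomial `∑ cᵢ Xⁱ` modulo `X ^ 13 - 1`, lies in the ideal generated by the
polynomial whose roots are `α ^ ℓ` for `ℓ` running over the nonzero squares mod 13;
equivalently (as that generator is separable and divides `X ^ 13 - 1`), the codeword
polynomial vanishes at `α ^ ℓ` for every nonzero square `ℓ` modulo 13. -/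
def qr3Mem {K : Type} [Field K] [Algebra (ZMod 3) K] (α : K) (c : Fin 13 → ZMod 3) : Prop :=
  ∀ ℓ : ZMod 13, ℓ ≠ 0 → IsSquare ℓ →
    ∑ i : Fin 13, algebraMap (ZMod 3) K (c i) * α ^ (ℓ.val * (i : ℕ)) = 0

/-- Membership in the extended ternary quadratic residue code of length 14: the first 13
coordinates form a codeword of the quadratic residue code of length 13 and the last
coordinate is minus the sum of the first 13. -/
def extQR3Mem {K : Type} [Field K] [Algebra (ZMod 3) K] (α : K) (c : Fin 14 → ZMod 3) : Prop :=
  qr3Mem α (fun i => c i.castSucc) ∧ c (Fin.last 13) = - ∑ i : Fin 13, c i.castSucc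

/-- Hamming weight: the number of nonzero coordinates. -/
def wt {n : ℕ} {F : Type} [Zero F] (c : Fin n → F) : ℕ :=
  (Finset.univ.filter fun i => c i ≠ 0).card

/-- Support: the set of nonzero coordinate positions. -/
def supp {n : ℕ} {F : Type} [Zero F] (c : Fin n → F) : Finset (Fin n) :=
  Finset.univ.filter fun i => c i ≠ 0

/-- The nonzero squares modulo 13, listed in the order `1, 3, 9, 12, 10, 4`. -/
def squareExponent : Fin 6 → ℕ := ![1, 3, 9, 12, 10, 4]

/-- The remainders of `X ^ 6, …, X ^ 12` modulo `X ^ 6 + 2 X ^ 4 + 2 X ^ 3 + 2 X ^ 2 + 1`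
over `ZMod 3`. -/
def remainders₁ : Matrix (Fin 7) (Fin 6) (ZMod 3) :=
  !![2, 0, 1, 1, 1, 0;
     0, 2, 0, 1, 1, 1;
     2, 0, 0, 1, 2, 1;
     2, 2, 1, 1, 2, 2;
     1, 2, 1, 0, 0, 2;
     1, 1, 1, 0, 2, 0;
     0, 1, 1, 1, 0, 2]

/-- The remainders of `X ^ 6, …, X ^ 12` modulo
`X ^ 6 + X ^ 5 + 2 X ^ 4 + 2 X ^ 2 + X + 1` over `ZMod 3`. -/
def remainders₂ : Matrix (Fin 7) (Fin 6) (ZMod 3) :=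
  !![2, 2, 1, 0, 1, 2;
     1, 0, 1, 1, 2, 2;
     1, 2, 2, 1, 0, 0;
     0, 1, 2, 2, 1, 0;
     0, 0, 1, 2, 2, 1;
     2, 2, 1, 1, 0, 1;
     2, 1, 0, 1, 2, 2]

/-- `β` satisfies `β ^ (6 + k) = ∑ j, R k j * β ^ j` for all `k < 7`. -/
def ReducesPowers {K : Type} [Field K] [Algebra (ZMod 3) K]
    (R : Matrix (Fin 7) (Fin 6) (ZMod 3)) (β : K) : Prop :=
  ∀ k : Fin 7, β ^ (6 + (k : ℕ)) = ∑ j : Fin 6, algebraMap (ZMod 3) K (R k j) * β ^ (j : ℕ)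

/-- The word of length 13 with information symbols `x` in the last seven positions and
check symbols determined by `R` in the first six. -/
def encode (R : Matrix (Fin 7) (Fin 6) (ZMod 3)) (x : Fin 7 → ZMod 3) : Fin 13 → ZMod 3 :=
  ![-∑ k, x k * R k 0, -∑ k, x k * R k 1, -∑ k, x k * R k 2, -∑ k, x k * R k 3,
    -∑ k, x k * R k 4, -∑ k, x k * R k 5, x 0, x 1, x 2, x 3, x 4, x 5, x 6]

/-- `encode`, extended by the negative of the sum of the coordinates. -/
def extEncode (R : Matrix (Fin 7) (Fin 6) (ZMod 3)) (x : Fin 7 → ZMod 3) : Fin 14 → ZMod 3 :=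
  Fin.snoc (encode R x) (-∑ i, encode R x i)

section Powers

variable {K : Type} [Field K]

/-- A property of 13th roots of unity that is stable under cubing and inversion passes from `α`
to its powers with nonzero square exponents. -/
theorem forall_squareExponent {P : K → Prop} {α : K} (h13 : α ^ 13 = 1) (h : P α)
    (hcube : ∀ β, P β → P (β ^ 3)) (hinv : ∀ β, β ≠ 0 → P β → P β⁻¹) (m : Fin 6) :
    P (α ^ squareExponent m) := by
  have h0 : α ≠ 0 := by rintro rfl; simp at h13
  have h3 := hcube _ h
  have h9 := hcube _ h3
  have key : ∀ a b : ℕ, a + b = 13 → P (α ^ a) → P (α ^ b) := fun a b hab ha => by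
    have := hinv _ (pow_ne_zero a h0) ha
    rwa [inv_eq_of_mul_eq_one_right (b := α ^ b) (by rw [← pow_add, hab, h13])] at this
  rw [← pow_mul] at h9
  fin_cases m
  · simpa [squareExponent] using h
  · exact h3
  · exact h9
  · exact key 1 12 rfl (by simpa using h)
  · exact key 3 10 rfl h3
  · exact key 9 4 rfl h9

variable [Algebra (ZMod 3) K]

theorem reducesPowers_remainders₁ {β : K}
    (h : β ^ 6 + 2 * β ^ 4 + 2 * β ^ 3 + 2 * β ^ 2 + 1 = 0) : ReducesPowers remainders₁ β := by
  have : CharP K 3 := charP_of_injective_algebraMap (algebraMap (ZMod 3) K).injective 3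
  have h2 : algebraMap (ZMod 3) K 2 = 2 := map_ofNat _ 2
  intro k
  fin_cases k <;> simp [remainders₁, Fin.sum_univ_succ] <;> grind

theorem reducesPowers_remainders₂ {β : K}
    (h : β ^ 6 + β ^ 5 + 2 * β ^ 4 + 2 * β ^ 2 + β + 1 = 0) : ReducesPowers remainders₂ β := by
  have : CharP K 3 := charP_of_injective_algebraMap (algebraMap (ZMod 3) K).injective 3
  have h2 : algebraMap (ZMod 3) K 2 = 2 := map_ofNat _ 2
  intro k
  fin_cases k <;> simp [remainders₂, Fin.sum_univ_succ] <;> grind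

/-- The 13th cyclotomic polynomial splits over `ZMod 3` into two factors, whose roots are closed
under raising to nonzero square exponents. -/
theorem exists_reducesPowers {α : K} (hα : IsPrimitiveRoot α 13) :
    (∀ m, ReducesPowers remainders₁ (α ^ squareExponent m)) ∨
      ∀ m, ReducesPowers remainders₂ (α ^ squareExponent m) := by
  have : CharP K 3 := charP_of_injective_algebraMap (algebraMap (ZMod 3) K).injective 3
  have hsum := hα.geom_sum_eq_zero (by norm_num)
  have hprod : (α ^ 6 + 2 * α ^ 4 + 2 * α ^ 3 + 2 * α ^ 2 + 1) *
      (α ^ 6 + α ^ 5 + 2 * α ^ 4 + 2 * α ^ 2 + α + 1) = 0 := by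
    simp only [Finset.sum_range_succ, Finset.sum_range_zero] at hsum
    grind
  rcases mul_eq_zero.mp hprod with h | h
  · refine .inl fun m => reducesPowers_remainders₁ ?_
    refine forall_squareExponent
      (P := fun β => β ^ 6 + 2 * β ^ 4 + 2 * β ^ 3 + 2 * β ^ 2 + 1 = 0) hα.pow_eq_one h
      (fun β hβ => ?_) (fun β h0 hβ => ?_) m
    · grind
    · field_simp
      grind
  · refine .inr fun m => reducesPowers_remainders₂ ?_
    refine forall_squareExponent
      (P := fun β => β ^ 6 + β ^ 5 + 2 * β ^ 4 + 2 * β ^ 2 + β + 1 = 0) hα.pow_eq_one h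
      (fun β hβ => ?_) (fun β h0 hβ => ?_) m
    · grind
    · field_simp
      grind

theorem qr3Mem_iff_squareExponent {α : K} {c : Fin 13 → ZMod 3} :
    qr3Mem α c ↔
      ∀ m, ∑ i : Fin 13, algebraMap (ZMod 3) K (c i) * (α ^ squareExponent m) ^ (i : ℕ) = 0 := by
  simp only [← pow_mul]
  constructor
  · intro h m
    have hsq : (squareExponent m : ZMod 13) ≠ 0 ∧ IsSquare (squareExponent m : ZMod 13) ∧
        (squareExponent m : ZMod 13).val = squareExponent m := by
      revert m
      decide
    simpa only [hsq.2.2] using h _ hsq.1 hsq.2.1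
  · intro h ℓ h0 hsq
    obtain ⟨m, hm⟩ : ∃ m, squareExponent m = ℓ.val := by
      revert ℓ
      decide
    simpa only [hm] using h m

theorem sum_mul_pow_eq_of_reducesPowers {R : Matrix (Fin 7) (Fin 6) (ZMod 3)} {β : K}
    (hR : ReducesPowers R β) (c : Fin 13 → ZMod 3) :
    ∑ i : Fin 13, algebraMap (ZMod 3) K (c i) * β ^ (i : ℕ) =
      ∑ j : Fin 6, algebraMap (ZMod 3) K
        (c (Fin.castAdd 7 j) + ∑ k : Fin 7, c (Fin.natAdd 6 k) * R k j) * β ^ (j : ℕ) := by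
  rw [Fin.sum_univ_add (a := 6) (b := 7)]
  simp only [map_add, map_sum, map_mul, add_mul, Finset.sum_add_distrib, Finset.sum_mul,
    Fin.val_castAdd, Fin.val_natAdd, hR _, Finset.mul_sum]
  rw [Finset.sum_comm (s := (Finset.univ : Finset (Fin 7)))]
  simp only [mul_assoc]

theorem qr3Mem_iff_eq_encode {R : Matrix (Fin 7) (Fin 6) (ZMod 3)} {α : K}
    (hα : IsPrimitiveRoot α 13) (hR : ∀ m, ReducesPowers R (α ^ squareExponent m))
    {c : Fin 13 → ZMod 3} :
    qr3Mem α c ↔ c = encode R fun k => c (Fin.natAdd 6 k) := by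
  have hinj : Function.Injective fun m => α ^ squareExponent m := fun a b hab => by
    have hlt : ∀ m, squareExponent m < 13 := by decide
    have hsq : Function.Injective squareExponent := by decide
    exact hsq (hα.pow_inj (hlt a) (hlt b) hab)
  have hcheck : qr3Mem α c ↔
      ∀ j, c (Fin.castAdd 7 j) + ∑ k : Fin 7, c (Fin.natAdd 6 k) * R k j = 0 := by
    simp only [qr3Mem_iff_squareExponent, sum_mul_pow_eq_of_reducesPowers (hR _)]
    refine ⟨fun h j => ?_, fun h m => by simp [h]⟩
    have := congrFun (Matrix.eq_zero_of_forall_index_sum_mul_pow_eq_zero hinj h) j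
    exact (map_eq_zero _).mp this
  rw [hcheck]
  simp only [add_eq_zero_iff_eq_neg]
  constructor
  · intro h
    funext i
    fin_cases i
    exacts [h 0, h 1, h 2, h 3, h 4, h 5, rfl, rfl, rfl, rfl, rfl, rfl, rfl]
  · intro h j
    have := congrFun h (Fin.castAdd 7 j)
    fin_cases j <;> exact this

end Powers

theorem encode_natAdd (R : Matrix (Fin 7) (Fin 6) (ZMod 3)) (x : Fin 7 → ZMod 3) (k : Fin 7) :
    encode R x (Fin.natAdd 6 k) = x k := by
  fin_cases k <;> rfl

/-- The coordinate of the extended code carrying the `k`-th information symbol. -/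
def infoPosition (k : Fin 7) : Fin 14 := (Fin.natAdd 6 k).castSucc

theorem extEncode_infoPosition (R : Matrix (Fin 7) (Fin 6) (ZMod 3)) (x : Fin 7 → ZMod 3)
    (k : Fin 7) : extEncode R x (infoPosition k) = x k := by
  rw [infoPosition, extEncode, Fin.snoc_castSucc, encode_natAdd]

theorem extEncode_injective (R : Matrix (Fin 7) (Fin 6) (ZMod 3)) :
    Function.Injective (extEncode R) := fun x y h => by
  funext k
  simpa only [extEncode_infoPosition] using congrFun h (infoPosition k)

theorem extQR3Mem_iff_mem_range {K : Type} [Field K] [Algebra (ZMod 3) K]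
    {R : Matrix (Fin 7) (Fin 6) (ZMod 3)} {α : K} (hα : IsPrimitiveRoot α 13)
    (hR : ∀ m, ReducesPowers R (α ^ squareExponent m)) {c : Fin 14 → ZMod 3} :
    extQR3Mem α c ↔ c ∈ Set.range (extEncode R) := by
  rw [extQR3Mem, qr3Mem_iff_eq_encode hα hR]
  constructor
  · rintro ⟨h, hlast⟩
    refine ⟨fun k => c (Fin.natAdd 6 k).castSucc, ?_⟩
    funext i
    refine Fin.lastCases ?_ (fun i => ?_) i
    · rw [hlast, extEncode, Fin.snoc_last, ← h]
    · rw [extEncode, Fin.snoc_castSucc, ← h]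
  · rintro ⟨x, rfl⟩
    simp only [extEncode, Fin.snoc_castSucc, Fin.snoc_last, encode_natAdd, and_self]

/-- The number of message words that are nonzero at the positions in `s` and whose codeword has
weight 10. -/
def shellCount (R : Matrix (Fin 7) (Fin 6) (ZMod 3)) (s : Finset (Fin 7)) : ℕ :=
  (Finset.univ.filter fun x : Fin 7 → ZMod 3 =>
    (∀ k ∈ s, x k ≠ 0) ∧ ∑ i, (if extEncode R x i = 0 then 0 else 1) = 10).card

theorem ncard_shell {K : Type} [Field K] [Algebra (ZMod 3) K]
    {R : Matrix (Fin 7) (Fin 6) (ZMod 3)} {α : K} (hα : IsPrimitiveRoot α 13)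
    (hR : ∀ m, ReducesPowers R (α ^ squareExponent m)) (s : Finset (Fin 7)) :
    {c : Fin 14 → ZMod 3 | extQR3Mem α c ∧ wt c = 10 ∧
      s.image infoPosition ⊆ supp c}.ncard = shellCount R s := by
  have hwt : ∀ c : Fin 14 → ZMod 3, wt c = ∑ i, if c i = 0 then 0 else 1 := fun c => by
    rw [wt, Finset.card_filter]
    exact Finset.sum_congr rfl fun i _ => by by_cases h : c i = 0 <;> simp [h]
  rw [shellCount, ← Set.ncard_coe_finset, ← Set.ncard_image_of_injective _ (extEncode_injective R)]
  congr 1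
  ext c
  simp only [Set.mem_ofPred_eq, Set.mem_image, Finset.coe_filter, Finset.mem_univ, true_and,
    extQR3Mem_iff_mem_range hα hR, Set.mem_range]
  have hsupp : ∀ x, s.image infoPosition ⊆ supp (extEncode R x) ↔
      ∀ k ∈ s, x k ≠ 0 := fun x => by
    simp only [Finset.subset_iff, Finset.forall_mem_image, supp, Finset.mem_filter,
      Finset.mem_univ, true_and, extEncode_infoPosition]
  constructor
  · rintro ⟨⟨x, rfl⟩, hw, hT⟩
    exact ⟨x, ⟨(hsupp x).mp hT, hwt _ ▸ hw⟩, rfl⟩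
  · rintro ⟨x, ⟨hT, hw⟩, rfl⟩
    exact ⟨⟨x, rfl⟩, (hwt _).trans hw, (hsupp x).mpr hT⟩

theorem extEncode_eq_sum (R : Matrix (Fin 7) (Fin 6) (ZMod 3)) (x : Fin 7 → ZMod 3) (i : Fin 14) :
    extEncode R x i = ∑ k, x k * extEncode R (Pi.single k 1) i := by
  have h : ∀ i, encode R x i = ∑ k, x k * encode R (Pi.single k 1) i := fun i => by
    fin_cases i <;> simp [encode, Pi.single_apply]
  refine Fin.lastCases ?_ (fun i => ?_) i
  · simp only [extEncode, Fin.snoc_last, h, mul_neg, Finset.sum_neg_distrib, Finset.mul_sum]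
    rw [Finset.sum_comm]
  · simp only [extEncode, Fin.snoc_castSucc]
    exact h i

/-- The columns of the generator matrix of the extended code, with entries in `{0, 1, 2}`. -/
def columns (R : Matrix (Fin 7) (Fin 6) (ZMod 3)) : List (List ℕ) :=
  List.ofFn fun i => List.ofFn fun k => (extEncode R (Pi.single k 1) i).val

/-- The dot product of two lists of natural numbers. -/
def listDot : List ℕ → List ℕ → ℕ
  | a :: l, b :: m => a * b + listDot l m
  | _, _ => 0

/-- The number of entries of `cols` whose dot product with `l` is not divisible by 3. -/
def listWeight (l : List ℕ) : List (List ℕ) → ℕ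
  | [] => 0
  | m :: cols => (if listDot l m % 3 = 0 then 0 else 1) + listWeight l cols

/-- The sum of `f` over all lists with entries in `{0, 1, 2}` that have the same length as the
given mask and are nonzero wherever the mask is `true`. -/
def sumWords : List Bool → (List ℕ → ℕ) → ℕ
  | [], f => f []
  | b :: mask, f =>
    (bif b then 0 else sumWords mask fun l => f (0 :: l)) + sumWords mask (fun l => f (1 :: l)) +
      sumWords mask fun l => f (2 :: l)

theorem sum_eq_sumWords {n : ℕ} (mask : Fin n → Bool) (f : List ℕ → ℕ) :
    (∑ x : Fin n → ZMod 3, if ∀ k, mask k → x k ≠ 0 then f (List.ofFn fun k => (x k).val) else 0) =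
      sumWords (List.ofFn mask) f := by
  induction n generalizing f with
  | zero => simp [sumWords]
  | succ n ih =>
    rw [← (Fin.consEquiv fun _ => ZMod 3).sum_comp, Fintype.sum_prod_type]
    simp only [Fin.consEquiv_apply, List.ofFn_succ, Fin.cons_zero, Fin.cons_succ,
      Fin.forall_fin_succ, ite_and, sumWords]
    have hsplit : ∀ a : ZMod 3, (∑ y : Fin n → ZMod 3, if mask 0 → a ≠ 0 then
        if ∀ k : Fin n, mask k.succ → y k ≠ 0 then f (a.val :: List.ofFn fun k => (y k).val) else 0
        else 0) = if mask 0 → a ≠ 0 then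
          sumWords (List.ofFn fun k => mask k.succ) (fun l => f (a.val :: l)) else 0 := fun a => by
      split_ifs
      · exact ih (fun k => mask k.succ) fun l => f (a.val :: l)
      · exact Finset.sum_const_zero
    simp only [hsplit]
    have hsum : ∀ g : ZMod 3 → ℕ, ∑ a, g a = g 0 + g 1 + g 2 := Fin.sum_univ_three
    have h1 : (1 : ZMod 3) ≠ 0 := by decide
    have h2 : (2 : ZMod 3) ≠ 0 := by decide
    rw [hsum, show (0 : ZMod 3).val = 0 from rfl, show (1 : ZMod 3).val = 1 from rfl,
      show (2 : ZMod 3).val = 2 from rfl]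
    cases mask 0 <;> simp [h1, h2]

theorem natCast_listDot_ofFn {n : ℕ} (x y : Fin n → ZMod 3) :
    (listDot (List.ofFn fun k => (x k).val) (List.ofFn fun k => (y k).val) : ZMod 3) =
      ∑ k, x k * y k := by
  induction n with
  | zero => simp [listDot]
  | succ n ih =>
    simp [List.ofFn_succ, listDot, Fin.sum_univ_succ, ih (fun k => x k.succ) fun k => y k.succ]

theorem listWeight_ofFn (l : List ℕ) {n : ℕ} (c : Fin n → List ℕ) :
    listWeight l (List.ofFn c) = ∑ i, if listDot l (c i) % 3 = 0 then 0 else 1 := by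
  induction n with
  | zero => simp [listWeight]
  | succ n ih => simp only [List.ofFn_succ, listWeight, Fin.sum_univ_succ, ih]

theorem shellCount_eq_sumWords (R : Matrix (Fin 7) (Fin 6) (ZMod 3)) (s : Finset (Fin 7)) :
    shellCount R s = sumWords (List.ofFn fun k => decide (k ∈ s)) fun l =>
      if listWeight l (columns R) = 10 then 1 else 0 := by
  rw [← sum_eq_sumWords, shellCount, Finset.card_filter]
  refine Finset.sum_congr rfl fun x _ => ?_
  have hzero : ∀ i, listDot (List.ofFn fun k => (x k).val)
      (List.ofFn fun k => (extEncode R (Pi.single k 1) i).val) % 3 = 0 ↔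
        extEncode R x i = 0 := fun i => by
    rw [extEncode_eq_sum, ← natCast_listDot_ofFn, ZMod.natCast_eq_zero_iff, Nat.dvd_iff_mod_eq_zero]
  simp only [columns, listWeight_ofFn, hzero, decide_eq_true_eq, ite_and]

theorem shellCount_remainders₁ :
    shellCount remainders₁ {0, 1, 2, 3} = 114 ∧ shellCount remainders₁ {0, 1, 2, 5} = 116 := by
  have hcols : columns remainders₁ = [
      [1, 0, 1, 1, 2, 2, 0], [0, 1, 0, 1, 1, 2, 2], [2, 0, 0, 2, 2, 2, 2], [2, 2, 2, 2, 0, 0, 2],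
      [2, 2, 1, 1, 0, 1, 0], [0, 2, 2, 1, 1, 0, 1], [1, 0, 0, 0, 0, 0, 0], [0, 1, 0, 0, 0, 0, 0],
      [0, 0, 1, 0, 0, 0, 0], [0, 0, 0, 1, 0, 0, 0], [0, 0, 0, 0, 1, 0, 0], [0, 0, 0, 0, 0, 1, 0],
      [0, 0, 0, 0, 0, 0, 1], [1, 1, 2, 0, 2, 1, 1]] := by
    decide +kernel
  simp only [shellCount_eq_sumWords, hcols]
  decide +kernel

theorem shellCount_remainders₂ :
    shellCount remainders₂ {0, 1, 2, 3} = 114 ∧ shellCount remainders₂ {0, 1, 2, 5} = 116 := by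
  have hcols : columns remainders₂ = [
      [1, 2, 2, 0, 0, 1, 1], [1, 0, 1, 2, 0, 1, 2], [2, 2, 1, 1, 2, 2, 0], [0, 2, 2, 1, 1, 2, 2],
      [2, 1, 0, 2, 1, 0, 1], [1, 1, 0, 0, 2, 2, 1], [1, 0, 0, 0, 0, 0, 0], [0, 1, 0, 0, 0, 0, 0],
      [0, 0, 1, 0, 0, 0, 0], [0, 0, 0, 1, 0, 0, 0], [0, 0, 0, 0, 1, 0, 0], [0, 0, 0, 0, 0, 1, 0],
      [0, 0, 0, 0, 0, 0, 1], [1, 0, 2, 2, 2, 0, 1]] := by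
    decide +kernel
  simp only [shellCount_eq_sumWords, hcols]
  decide +kernel

/-- For the extended ternary quadratic residue code `C` of length 14, the shell `C₁₀` is not
a combinatorial 4-design with repeated blocks: there is no `λ` such that every 4-element
subset of the coordinates is contained in the support of exactly `λ` codewords of
weight 10. -/
theorem ternary_shell_ten_not_four_design (K : Type) [Field K] [Algebra (ZMod 3) K] (α : K)
    (hα : IsPrimitiveRoot α 13) :
    ¬ ∃ lam : ℕ, ∀ T : Finset (Fin 14), T.card = 4 →
      {c : Fin 14 → ZMod 3 | extQR3Mem α c ∧ wt c = 10 ∧ T ⊆ supp c}.ncard = lam := by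
  rintro ⟨lam, hlam⟩
  have hcount : ∀ R, (∀ m, ReducesPowers R (α ^ squareExponent m)) →
      ¬(shellCount R {0, 1, 2, 3} = 114 ∧ shellCount R {0, 1, 2, 5} = 116) := fun R hR => by
    rw [← ncard_shell hα hR, ← ncard_shell hα hR, hlam _ (by decide), hlam _ (by decide)]
    omega
  rcases exists_reducesPowers hα with hR | hR
  · exact hcount _ hR shellCount_remainders₁
  · exact hcount _ hR shellCount_remainders₂
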